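/- Let N ≥ 1, α > 0, β ∈ ℝ with α + β > 0, ε ∈ (0, π/2) and λ ∈ Σ_ε. For g ∈ 𝒮(ℝ^N; ℂ^N) define u = F^{−1}[ (λ + α|ξ|²)^{−1} F[g](ξ) ] + β F^{−1}[ iξ ( iξ · F[g](ξ) ) / ( (λ + α|ξ|²)(λ + (α+β)|ξ|²) ) ]. Then u ∈ 𝒮(ℝ^N; ℂ^N), its divergence satisfies div u = F^{−1}[ ( iξ · F[g](ξ) ) / ( λ + (α+β)|ξ|² ) ], and u solves the whole-space Lamé equations λ u − α Δu − β ∇(div u) = g on ℝ^N. -/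

import Mathlib

open MeasureTheory

noncomputable section

variable {N : ℕ}

/-- The Fourier transform `F[g](ξ) = ∫ g(x) e^{−i x·ξ} dx` on `ℝ^N` (scalar-valued). -/
def FT (g : (Fin N → ℝ) → ℂ) (ξ : Fin N → ℝ) : ℂ :=
  ∫ x : Fin N → ℝ, g x * Complex.exp (-Complex.I * ((∑ j, x j * ξ j : ℝ) : ℂ))

/-- The inverse Fourier transform `F⁻¹[h](x) = (2π)^{−N} ∫ h(ξ) e^{i x·ξ} dξ` on `ℝ^N`. -/
def FTinv (h : (Fin N → ℝ) → ℂ) (x : Fin N → ℝ) : ℂ :=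
  (((2 * Real.pi) ^ N : ℝ) : ℂ)⁻¹ *
    ∫ ξ : Fin N → ℝ, h ξ * Complex.exp (Complex.I * ((∑ j, x j * ξ j : ℝ) : ℂ))

/-- Squared Euclidean norm `|ξ|² = Σ ξ_j²`. -/
def sqNorm (ξ : Fin N → ℝ) : ℝ := ∑ j, ξ j ^ 2

/-- Divergence `div u = Σ_k ∂_k u_k`. -/
def divergence (u : (Fin N → ℝ) → (Fin N → ℂ)) (x : Fin N → ℝ) : ℂ :=
  ∑ k, fderiv ℝ (fun y => u y k) x (Pi.single k 1)

/-- Laplacian `Δw = Σ_k ∂_k² w` of a scalar function. -/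
def lap (w : (Fin N → ℝ) → ℂ) (x : Fin N → ℝ) : ℂ :=
  ∑ k, fderiv ℝ (fun y => fderiv ℝ w y (Pi.single k 1)) x (Pi.single k 1)


section helpers

open scoped SchwartzMap FourierTransform ContDiff LineDeriv

/-- Polynomial bounds on derivatives up to order `n`. -/
def PB {E F : Type*} [NormedAddCommGroup E] [NormedSpace ℝ E] [NormedAddCommGroup F]
    [NormedSpace ℝ F] (n : ℕ) (f : E → F) : Prop :=
  ∃ (k : ℕ) (C : ℝ), 0 ≤ C ∧ ∀ m ≤ n, ∀ x, ‖iteratedFDeriv ℝ m f x‖ ≤ C * (1 + ‖x‖) ^ k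

lemma PB.smul {E F : Type*} [NormedAddCommGroup E] [NormedSpace ℝ E] [NormedAddCommGroup F]
    [NormedSpace ℝ F] [NormedSpace ℂ F] [IsScalarTower ℝ ℂ F] {n : ℕ} {f : E → ℂ} {g : E → F}
    (hf : ContDiff ℝ ∞ f) (hg : ContDiff ℝ ∞ g) (h1 : PB n f) (h2 : PB n g) :
    PB n (fun x => f x • g x) := by
  obtain ⟨k1, C1, hC1, h1⟩ := h1
  obtain ⟨k2, C2, hC2, h2⟩ := h2
  refine ⟨k1 + k2, 2 ^ n * (C1 * C2), by positivity, fun m hm x => ?_⟩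
  have := norm_iteratedFDeriv_smul_le hf hg x (n := m) (by exact_mod_cast le_top)
  refine this.trans ?_
  calc _ ≤ ∑ i ∈ Finset.range (m + 1), (m.choose i : ℝ) * (C1 * C2 * (1 + ‖x‖) ^ (k1 + k2)) := by
        apply Finset.sum_le_sum
        intro i hi
        have hi' : i ≤ m := by simpa [Nat.lt_succ_iff] using hi
        rw [mul_assoc]
        refine mul_le_mul_of_nonneg_left ?_ (by positivity)
        calc _ ≤ (C1 * (1 + ‖x‖) ^ k1) * (C2 * (1 + ‖x‖) ^ k2) := by
              gcongr
              · exact h1 i (hi'.trans hm) x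
              · exact h2 (m - i) ((Nat.sub_le _ _).trans hm) x
          _ = _ := by rw [pow_add]; ring
    _ = 2 ^ m * (C1 * C2 * (1 + ‖x‖) ^ (k1 + k2)) := by
        rw [← Finset.sum_mul]
        congr 1
        exact_mod_cast Nat.sum_range_choose m
    _ ≤ 2 ^ n * (C1 * C2 * (1 + ‖x‖) ^ (k1 + k2)) := by
        gcongr
        norm_num
    _ = _ := by ring

lemma hasTemperateGrowth_inv {E : Type*} [NormedAddCommGroup E] [NormedSpace ℝ E] {f : E → ℂ}
    (hf : f.HasTemperateGrowth) {c : ℝ} (hc : 0 < c) (h : ∀ x, c ≤ ‖f x‖) :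
    (fun x => (f x)⁻¹).HasTemperateGrowth := by
  have hne : ∀ x, f x ≠ 0 := fun x => norm_pos_iff.1 (hc.trans_le (h x))
  have hcd : ContDiff ℝ ∞ (fun x => (f x)⁻¹) := hf.1.inv hne
  have hfd : fderiv ℝ (fun x => (f x)⁻¹) =
      fun x => (f x)⁻¹ • ((f x)⁻¹ • (-(fderiv ℝ f x))) := by
    ext x v
    have h1 : HasFDerivAt f (fderiv ℝ f x) x :=
      (hf.1.differentiable (by simp)).differentiableAt.hasFDerivAt
    have h2 := (hasFDerivAt_inv (𝕜 := ℂ) (hne x)).restrictScalars ℝ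
    have h3 := h2.comp x h1
    have h4 : fderiv ℝ (fun x => (f x)⁻¹) x = _ := h3.fderiv
    rw [h4]
    simp
    ring
  have hcf : ContDiff ℝ ∞ (fun x => -(fderiv ℝ f x)) :=
    (hf.1.fderiv_right (m := ∞) (by simp)).neg
  have key : ∀ n, PB n (fun x => (f x)⁻¹) := by
    intro n
    induction n with
    | zero =>
      refine ⟨0, c⁻¹, by positivity, fun m hm x => ?_⟩
      obtain rfl : m = 0 := by omega
      simp only [norm_iteratedFDeriv_zero, norm_inv, pow_zero, mul_one]
      gcongr
      exact h x
    | succ n ih =>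
      have hfn : PB n (fun x => -(fderiv ℝ f x)) := by
        obtain ⟨k, C, hC, hb⟩ := hf.norm_iteratedFDeriv_le_uniform (n + 1)
        refine ⟨k, C, hC, fun m hm x => ?_⟩
        have : iteratedFDeriv ℝ m (fun x => -(fderiv ℝ f x)) x =
            - iteratedFDeriv ℝ m (fderiv ℝ f) x := by
          exact iteratedFDeriv_neg_apply
        rw [this, norm_neg, norm_iteratedFDeriv_fderiv]
        exact hb (m + 1) (by omega) x
      have := PB.smul hcd (hcd.smul hcf) ih (PB.smul hcd hcf ih hfn)
      obtain ⟨k1, C1, hC1, h1⟩ := this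
      obtain ⟨k2, C2, hC2, h2⟩ := ih
      refine ⟨k1 + k2, C1 + C2, by positivity, fun m hm x => ?_⟩
      have hx : 1 ≤ 1 + ‖x‖ := by simp
      rcases m with _ | m
      · calc _ ≤ C2 * (1 + ‖x‖) ^ k2 := h2 0 (by omega) x
          _ ≤ _ := by
            gcongr
            · linarith
            · omega
      · rw [← norm_iteratedFDeriv_fderiv, hfd]
        calc _ ≤ C1 * (1 + ‖x‖) ^ k1 := h1 m (by omega) x
          _ ≤ _ := by
            gcongr
            · linarith
            · omega
  refine ⟨hcd, fun n => ?_⟩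
  obtain ⟨k, C, _, hb⟩ := key n
  exact ⟨k, C, hb n le_rfl⟩

/-- The linear identification of `ℝ^N` with Euclidean space. -/
def eqv (N : ℕ) : (Fin N → ℝ) ≃L[ℝ] EuclideanSpace ℝ (Fin N) :=
  (EuclideanSpace.equiv (Fin N) ℝ).symm

lemma two_pi_ne : (2 * Real.pi) ≠ 0 := by positivity

/-- Scaled identification. -/
def eqs (N : ℕ) : (Fin N → ℝ) ≃L[ℝ] EuclideanSpace ℝ (Fin N) :=
  (eqv N).trans (ContinuousLinearEquiv.smulLeft (Units.mk0 (2 * Real.pi) two_pi_ne)⁻¹)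

lemma eqs_apply (ξ : Fin N → ℝ) : eqs N ξ = (2 * Real.pi)⁻¹ • WithLp.toLp 2 ξ := rfl

lemma eqs_symm_apply (η : EuclideanSpace ℝ (Fin N)) :
    (eqs N).symm η = (2 * Real.pi) • WithLp.ofLp η := by
  apply (eqs N).injective
  rw [ContinuousLinearEquiv.apply_symm_apply, eqs_apply]
  ext i
  simp
  field_simp

/-- Fourier transform as a Schwartz map. -/
def FTS (g : 𝓢(Fin N → ℝ, ℂ)) : 𝓢(Fin N → ℝ, ℂ) :=
  SchwartzMap.compCLMOfContinuousLinearEquiv ℂ (eqs N)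
    (𝓕 (SchwartzMap.compCLMOfContinuousLinearEquiv ℂ (eqv N).symm g))

/-- Inverse Fourier transform as a linear map on Schwartz maps. -/
def FTI (N : ℕ) : 𝓢(Fin N → ℝ, ℂ) →L[ℂ] 𝓢(Fin N → ℝ, ℂ) :=
  SchwartzMap.compCLMOfContinuousLinearEquiv ℂ (eqv N) ∘L
    (FourierTransform.fourierInvCLM ℂ 𝓢(EuclideanSpace ℝ (Fin N), ℂ)) ∘L
    SchwartzMap.compCLMOfContinuousLinearEquiv ℂ (eqs N).symm

lemma FTS_apply (g : 𝓢(Fin N → ℝ, ℂ)) (ξ : Fin N → ℝ) : FTS g ξ = FT g ξ := by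
  simp only [FTS, SchwartzMap.compCLMOfContinuousLinearEquiv_apply, Function.comp_apply,
    SchwartzMap.fourier_coe, Real.fourier_eq', FT]
  rw [← (PiLp.volume_preserving_toLp (Fin N)).integral_comp
    (MeasurableEquiv.toLp 2 _).measurableEmbedding]
  refine integral_congr_ae (Filter.Eventually.of_forall fun x => ?_)
  have h1 : (eqv N).symm (WithLp.toLp 2 x) = x := rfl
  simp only [h1, smul_eq_mul, Function.comp_apply]
  rw [mul_comm]
  congr 2
  rw [eqs_apply, inner_smul_right]
  have : inner ℝ (WithLp.toLp 2 x) (WithLp.toLp 2 ξ) = ∑ j, x j * ξ j := by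
    simp [PiLp.inner_apply, mul_comm]
  rw [this]
  have h2 : -2 * Real.pi * ((2 * Real.pi)⁻¹ * ∑ j, x j * ξ j) = -∑ j, x j * ξ j := by
    field_simp [Real.pi_ne_zero]
  rw [h2]
  push_cast
  ring

lemma FTI_apply (h : 𝓢(Fin N → ℝ, ℂ)) (x : Fin N → ℝ) : FTI N h x = FTinv h x := by
  have e0 : FTI N h x = 𝓕⁻ (⇑(SchwartzMap.compCLMOfContinuousLinearEquiv ℂ (eqs N).symm h))
      (eqv N x) := by
    rw [← SchwartzMap.fourierInv_coe]
    rfl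
  rw [e0]
  simp only [SchwartzMap.compCLMOfContinuousLinearEquiv_apply, Real.fourierInv_eq', FTinv]
  rw [← (PiLp.volume_preserving_toLp (Fin N)).integral_comp
    (MeasurableEquiv.toLp 2 _).measurableEmbedding]
  have key := Measure.integral_comp_smul (volume : Measure (Fin N → ℝ))
    (fun ξ => h ξ * Complex.exp (Complex.I * ((∑ j, x j * ξ j : ℝ) : ℂ))) (2 * Real.pi)
  have hp : (0 : ℝ) < (2 * Real.pi) ^ N := by positivity
  simp only [Module.finrank_fin_fun, abs_inv, abs_of_pos hp] at key
  rw [Complex.real_smul, Complex.ofReal_inv] at key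
  rw [← key]
  refine integral_congr_ae (Filter.Eventually.of_forall fun ξ => ?_)
  simp only [smul_eq_mul, Function.comp_apply, eqs_symm_apply]
  rw [mul_comm]
  congr 2
  have : inner ℝ (WithLp.toLp 2 ξ) (eqv N x) = ∑ j, x j * ξ j := by
    change inner ℝ (WithLp.toLp 2 ξ) (WithLp.toLp 2 x) = _
    simp [PiLp.inner_apply]
  rw [this, mul_comm Complex.I]
  congr 2
  rw [Finset.mul_sum]
  refine Finset.sum_congr rfl fun j _ => ?_
  simp
  ring

lemma FTI_FTS (g : 𝓢(Fin N → ℝ, ℂ)) : FTI N (FTS g) = g := by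
  have e1 : SchwartzMap.compCLMOfContinuousLinearEquiv ℂ (eqs N).symm (FTS g) =
      𝓕 (SchwartzMap.compCLMOfContinuousLinearEquiv ℂ (eqv N).symm g) := by
    ext x
    simp [FTS]
  ext x
  simp [FTI, e1]

/-- Multiplication by `i ξ_k`. -/
def ix (k : Fin N) (ξ : Fin N → ℝ) : ℂ := Complex.I * ((ξ k : ℝ) : ℂ)

lemma ix_tg (k : Fin N) : (ix k).HasTemperateGrowth := by
  have h1 : (fun ξ : Fin N → ℝ => ((ξ k : ℝ) : ℂ)).HasTemperateGrowth :=
    (Complex.ofRealCLM ∘L (ContinuousLinearMap.proj (R := ℝ) (φ := fun _ : Fin N => ℝ) k)).hasTemperateGrowth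
  exact (Function.HasTemperateGrowth.const _).mul h1

lemma FTI_deriv (h : 𝓢(Fin N → ℝ, ℂ)) (k : Fin N) (x : Fin N → ℝ) :
    fderiv ℝ (FTI N h) x (Pi.single k 1) = FTI N (SchwartzMap.smulLeftCLM ℂ (ix k) h) x := by
  rw [← SchwartzMap.lineDerivOp_apply_eq_fderiv]
  simp only [FTI, ContinuousLinearMap.comp_apply, FourierTransform.fourierInvCLM_apply]
  rw [SchwartzMap.lineDerivOp_compCLMOfContinuousLinearEquiv,
    SchwartzMap.lineDerivOp_fourierInv_eq]
  congr 3
  ext η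
  have ht : (fun y : EuclideanSpace ℝ (Fin N) =>
      inner ℝ y (eqv N (Pi.single k 1))).HasTemperateGrowth := by fun_prop
  have hin : inner ℝ η (eqv N (Pi.single k 1)) = η k := by
    change inner ℝ η (EuclideanSpace.single k (1 : ℝ)) = _
    simp [EuclideanSpace.inner_single_right]
  simp only [_root_.smul_apply, SchwartzMap.smulLeftCLM_apply_apply ht,
    SchwartzMap.compCLMOfContinuousLinearEquiv_apply, Function.comp_apply,
    SchwartzMap.smulLeftCLM_apply_apply (ix_tg k), hin, ix, eqs_symm_apply]
  simp
  ring

lemma sqNorm_tg : (fun ξ : Fin N → ℝ => ((sqNorm ξ : ℝ) : ℂ)).HasTemperateGrowth := by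
  have : (fun ξ : Fin N → ℝ => ((sqNorm ξ : ℝ) : ℂ)) = fun ξ => ∑ k, -(ix k ξ * ix k ξ) := by
    ext ξ
    simp only [sqNorm, ix]
    push_cast
    refine Finset.sum_congr rfl fun k _ => ?_
    linear_combination ((ξ k : ℂ) ^ 2) * Complex.I_sq
  rw [this]
  exact Function.HasTemperateGrowth.sum fun k _ => ((ix_tg k).mul (ix_tg k)).neg

lemma lower (l : ℂ) (hl : l ∈ Complex.slitPlane) :
    ∃ c : ℝ, 0 < c ∧ ∀ s : ℝ, 0 ≤ s → c ≤ ‖l + (s : ℂ)‖ := by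
  rcases hl with h | h
  · refine ⟨l.re, h, fun s hs => ?_⟩
    refine le_trans ?_ (Complex.re_le_norm _)
    simpa using hs
  · refine ⟨|l.im|, abs_pos.2 h, fun s hs => ?_⟩
    refine le_trans ?_ (Complex.abs_im_le_norm _)
    simp

lemma sqNorm_nonneg (ξ : Fin N → ℝ) : 0 ≤ sqNorm ξ :=
  Finset.sum_nonneg fun _ _ => sq_nonneg _

/-- The resolvent symbol. -/
def rs (l : ℂ) (a : ℝ) (ξ : Fin N → ℝ) : ℂ := (l + ((a * sqNorm ξ : ℝ) : ℂ))⁻¹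

lemma den_ne {l : ℂ} (hl : l ∈ Complex.slitPlane) {a : ℝ} (ha : 0 < a) (ξ : Fin N → ℝ) :
    l + ((a * sqNorm ξ : ℝ) : ℂ) ≠ 0 := by
  obtain ⟨c, hc, h⟩ := lower l hl
  exact norm_pos_iff.1 (hc.trans_le (h _ (mul_nonneg ha.le (sqNorm_nonneg ξ))))

lemma rs_tg {l : ℂ} (hl : l ∈ Complex.slitPlane) {a : ℝ} (ha : 0 < a) :
    (rs l a : (Fin N → ℝ) → ℂ).HasTemperateGrowth := by
  obtain ⟨c, hc, h⟩ := lower l hl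
  refine hasTemperateGrowth_inv ?_ hc
    (fun ξ => h _ (mul_nonneg ha.le (sqNorm_nonneg ξ)))
  have : (fun ξ : Fin N → ℝ => l + ((a * sqNorm ξ : ℝ) : ℂ)) =
      fun ξ => l + (a : ℂ) * ((sqNorm ξ : ℝ) : ℂ) := by
    ext ξ; push_cast; rfl
  rw [this]
  exact (Function.HasTemperateGrowth.const _).add
    ((Function.HasTemperateGrowth.const _).mul sqNorm_tg)

lemma sum_ix (ξ : Fin N → ℝ) : ∑ k, ix k ξ * ix k ξ = -((sqNorm ξ : ℝ) : ℂ) := by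
  simp only [sqNorm, ix]
  push_cast
  rw [← Finset.sum_neg_distrib]
  refine Finset.sum_congr rfl fun k _ => ?_
  linear_combination ((ξ k : ℂ) ^ 2) * Complex.I_sq

end helpers

/-- For λ ∈ Σ_ε and Schwartz `g`, the function
`u = F⁻¹[(λ+α|ξ|²)⁻¹ F[g]] + β F⁻¹[iξ (iξ·F[g]) / ((λ+α|ξ|²)(λ+(α+β)|ξ|²))]`
is Schwartz, satisfies `div u = F⁻¹[(iξ·F[g])/(λ+(α+β)|ξ|²)]`, and solves the
whole-space Lamé equations `λu − αΔu − β∇(div u) = g` on `ℝ^N`. -/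
theorem stmt_13 (N : ℕ) (hN : 1 ≤ N) (α β : ℝ) (hα : 0 < α) (hαβ : 0 < α + β)
    (ε : ℝ) (hε : ε ∈ Set.Ioo 0 (Real.pi / 2)) (l : ℂ) (hl0 : l ≠ 0)
    (harg : |l.arg| ≤ Real.pi - ε)
    (g : SchwartzMap (Fin N → ℝ) (Fin N → ℂ)) :
    let u : (Fin N → ℝ) → (Fin N → ℂ) := fun x j =>
      FTinv (fun ξ => (l + ((α * sqNorm ξ : ℝ) : ℂ))⁻¹ * FT (fun y => g y j) ξ) x +
        (β : ℂ) *
          FTinv (fun ξ =>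
            (Complex.I * ((ξ j : ℝ) : ℂ)) *
              (∑ k, Complex.I * ((ξ k : ℝ) : ℂ) * FT (fun y => g y k) ξ) /
              ((l + ((α * sqNorm ξ : ℝ) : ℂ)) *
                (l + (((α + β) * sqNorm ξ : ℝ) : ℂ)))) x
    (ContDiff ℝ (⊤ : ℕ∞) u ∧
      ∀ k n : ℕ, ∃ Ckn : ℝ, ∀ x : Fin N → ℝ,
        ‖x‖ ^ k * ‖iteratedFDeriv ℝ n u x‖ ≤ Ckn) ∧
    (∀ x : Fin N → ℝ,
      divergence u x =
        FTinv (fun ξ =>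
          (∑ k, Complex.I * ((ξ k : ℝ) : ℂ) * FT (fun y => g y k) ξ) /
            (l + (((α + β) * sqNorm ξ : ℝ) : ℂ))) x) ∧
    (∀ (x : Fin N → ℝ) (j : Fin N),
      l * u x j - (α : ℂ) * lap (fun y => u y j) x -
          (β : ℂ) * fderiv ℝ (fun y => divergence u y) x (Pi.single j 1) =
        g x j) := by
  intro u
  have hl : l ∈ Complex.slitPlane := by
    rw [Complex.mem_slitPlane_iff_arg]
    refine ⟨fun h => ?_, hl0⟩
    rw [h, abs_of_pos Real.pi_pos] at harg
    linarith [hε.1]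
  have tA := rs_tg (N := N) hl hα
  have tB := rs_tg (N := N) hl hαβ
  -- components
  let gc : Fin N → SchwartzMap (Fin N → ℝ) ℂ := fun j =>
    g.postcompCLM (ContinuousLinearMap.proj (R := ℂ) (φ := fun _ : Fin N => ℂ) j)
  let G : Fin N → SchwartzMap (Fin N → ℝ) ℂ := fun j => FTS (gc j)
  have hG : ∀ j ξ, FT (fun y => g y j) ξ = G j ξ := fun j ξ => (FTS_apply (gc j) ξ).symm
  let D : SchwartzMap (Fin N → ℝ) ℂ := ∑ k, SchwartzMap.smulLeftCLM ℂ (ix k) (G k)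
  have hD : ∀ ξ, D ξ = ∑ k, ix k ξ * G k ξ := by
    intro ξ
    simp only [D, _root_.sum_apply, SchwartzMap.smulLeftCLM_apply_apply (ix_tg _),
      smul_eq_mul]
  let B : SchwartzMap (Fin N → ℝ) ℂ := SchwartzMap.smulLeftCLM ℂ (rs l (α + β)) D
  have hB : ∀ ξ, B ξ = rs l (α + β) ξ * D ξ := fun ξ => by
    simp only [B, SchwartzMap.smulLeftCLM_apply_apply tB, smul_eq_mul]
  let V1 : Fin N → SchwartzMap (Fin N → ℝ) ℂ := fun j => SchwartzMap.smulLeftCLM ℂ (rs l α) (G j)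
  let V2 : Fin N → SchwartzMap (Fin N → ℝ) ℂ := fun j =>
    SchwartzMap.smulLeftCLM ℂ (ix j) (SchwartzMap.smulLeftCLM ℂ (rs l α) B)
  let V : Fin N → SchwartzMap (Fin N → ℝ) ℂ := fun j => V1 j + (β : ℂ) • V2 j
  have hV1 : ∀ j ξ, V1 j ξ = rs l α ξ * G j ξ := fun j ξ => by
    simp only [V1, SchwartzMap.smulLeftCLM_apply_apply tA, smul_eq_mul]
  have hV2 : ∀ j ξ, V2 j ξ = ix j ξ * (rs l α ξ * (rs l (α + β) ξ * D ξ)) := fun j ξ => by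
    simp only [V2, SchwartzMap.smulLeftCLM_apply_apply tA,
      SchwartzMap.smulLeftCLM_apply_apply (ix_tg _), smul_eq_mul, hB]
  have hV : ∀ j ξ, V j ξ = V1 j ξ + (β : ℂ) * V2 j ξ := fun j ξ => rfl
  have hu : ∀ x j, u x j = FTI N (V j) x := by
    intro x j
    have e1 : (fun ξ => (l + ((α * sqNorm ξ : ℝ) : ℂ))⁻¹ * FT (fun y => g y j) ξ) = V1 j := by
      ext ξ
      rw [hV1, hG]; rfl
    have e2 : (fun ξ : Fin N → ℝ =>
            (Complex.I * ((ξ j : ℝ) : ℂ)) *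
              (∑ k, Complex.I * ((ξ k : ℝ) : ℂ) * FT (fun y => g y k) ξ) /
              ((l + ((α * sqNorm ξ : ℝ) : ℂ)) *
                (l + (((α + β) * sqNorm ξ : ℝ) : ℂ)))) = V2 j := by
      ext ξ
      rw [hV2, hD]
      simp only [hG, ix, rs, div_eq_mul_inv, mul_inv]
      ring
    simp only [u]
    rw [e1, e2, ← FTI_apply, ← FTI_apply]
    simp only [V, map_add, map_smul, _root_.add_apply, _root_.smul_apply, smul_eq_mul]
  have huj : ∀ j, (fun y => u y j) = FTI N (V j) := fun j => funext fun y => hu y j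
  have hdivS : ∀ x, divergence u x = FTI N B x := by
    intro x
    simp only [divergence, huj, FTI_deriv]
    rw [← _root_.sum_apply, ← map_sum]
    congr 2
    ext ξ
    simp only [_root_.sum_apply, SchwartzMap.smulLeftCLM_apply_apply (ix_tg _), smul_eq_mul,
      hV, hV1, hV2, hB]
    have e : ∀ k, ix k ξ * (rs l α ξ * G k ξ +
        (β : ℂ) * (ix k ξ * (rs l α ξ * (rs l (α + β) ξ * D ξ)))) =
        rs l α ξ * (ix k ξ * G k ξ) +
          (ix k ξ * ix k ξ) * ((β : ℂ) * (rs l α ξ * (rs l (α + β) ξ * D ξ))) := fun k => by ring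
    simp only [e]
    rw [Finset.sum_add_distrib, ← Finset.mul_sum, ← Finset.sum_mul, sum_ix, ← hD]
    have d1 := den_ne hl hα ξ
    have d2 := den_ne hl hαβ ξ
    simp only [rs]
    have hq : l + (((α + β) * sqNorm ξ : ℝ) : ℂ) =
        l + ((α * sqNorm ξ : ℝ) : ℂ) + (β : ℂ) * ((sqNorm ξ : ℝ) : ℂ) := by
      push_cast
      ring
    generalize l + (((α + β) * sqNorm ξ : ℝ) : ℂ) = q at *
    generalize l + ((α * sqNorm ξ : ℝ) : ℂ) = p at *
    have hp : p = q - (β : ℂ) * ((sqNorm ξ : ℝ) : ℂ) := by rw [hq]; ring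
    field_simp
    rw [hp]
    ring
  refine ⟨?_, ?_, ?_⟩
  · let S : SchwartzMap (Fin N → ℝ) (Fin N → ℂ) :=
      ∑ j, (FTI N (V j)).postcompCLM
        (ContinuousLinearMap.single ℂ (fun _ : Fin N => ℂ) j)
    have hS : u = S := by
      ext x j
      simp only [S, _root_.sum_apply, SchwartzMap.postcompCLM_apply, hu, Finset.sum_apply]
      rw [Finset.sum_eq_single j]
      · simp
      · intro b _ hb
        simp [Pi.single_eq_of_ne hb.symm]
      · simp
    rw [hS]
    exact ⟨S.smooth', S.decay'⟩
  · intro x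
    rw [hdivS, FTI_apply]
    congr 1
    ext ξ
    rw [hB, hD]
    simp only [hG, ix, rs, div_eq_mul_inv]
    ring
  · intro x j
    have hdd : (fun y => divergence u y) = FTI N B := funext hdivS
    rw [hdd, FTI_deriv, hu, huj]
    simp only [lap, FTI_deriv]
    have hfin : l • V j - (α : ℂ) • (∑ k, SchwartzMap.smulLeftCLM ℂ (ix k)
        (SchwartzMap.smulLeftCLM ℂ (ix k) (V j))) -
        (β : ℂ) • SchwartzMap.smulLeftCLM ℂ (ix j) B = G j := by
      ext ξ
      simp only [_root_.sub_apply, _root_.smul_apply, _root_.sum_apply,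
        SchwartzMap.smulLeftCLM_apply_apply (ix_tg _), smul_eq_mul, ← mul_assoc]
      rw [← Finset.sum_mul, sum_ix]
      simp only [hV, hV1, hV2, hB]
      have d1 := den_ne hl hα ξ
      have d2 := den_ne hl hαβ ξ
      simp only [rs]
      field_simp
      push_cast
      ring
    have h2 := congrArg (fun h => FTI N h x) hfin
    simp only [map_sub, map_smul, map_sum, _root_.sub_apply, _root_.smul_apply,
      _root_.sum_apply, smul_eq_mul] at h2
    rw [h2]
    simp only [G, FTI_FTS]
    rfl
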